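/- arXiv:2406.15868 — 2 statements merged into one kernel-verified Lean document; each statement's English description precedes it below -/
import Mathlib

section
/- Let k be an algebraically closed field and let S = V(f) ⊆ P³ be a smooth surface of degree d ≥ 3 containing two skew lines L and M (distinct lines on S with L ∩ M = 0). Then the set of lines on S that are skew to L is finite and has cardinality at most (d−1)⁴. -/
open MvPolynomial

/-- `W` is a line (2-dimensional linear subspace of `k⁴`) lying on the surface `V(f) ⊆ P³`. -/
def IsLineOn {k : Type*} [Field k] (f : MvPolynomial (Fin 4) k)
    (W : Submodule k (Fin 4 → k)) : Prop :=
  Module.finrank k W = 2 ∧ ∀ v ∈ W, MvPolynomial.eval v f = 0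

/-- `f` is a nonzero homogeneous polynomial of degree `d` in `k[x,y,z,w]` such that `f` and its
four partial derivatives have no common zero in `k⁴ ∖ {0}`; i.e. `V(f) ⊆ P³` is a smooth
surface of degree `d`. -/
def IsSmoothSurface {k : Type*} [Field k] (f : MvPolynomial (Fin 4) k) (d : ℕ) : Prop :=
  f ≠ 0 ∧ f.IsHomogeneous d ∧
    ∀ v : Fin 4 → k, v ≠ 0 →
      ¬ (MvPolynomial.eval v f = 0 ∧
         ∀ i : Fin 4, MvPolynomial.eval v (MvPolynomial.pderiv i f) = 0)

namespace SkewLineBound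

theorem le_of_forall_mul_pow_le {N D c n : ℕ} (h : ∀ m : ℕ, N * m ^ n ≤ (D * m + c) ^ n) :
    N ≤ D ^ n := by
  have hlim : Filter.Tendsto (fun m : ℕ => ((D : ℝ) + c / m) ^ n) Filter.atTop
      (nhds ((D + 0 : ℝ) ^ n)) :=
    ((tendsto_const_div_atTop_nhds_zero_nat (c : ℝ)).const_add (D : ℝ)).pow n
  have hle : (N : ℝ) ≤ (D + 0 : ℝ) ^ n := by
    refine ge_of_tendsto hlim (Filter.eventually_atTop.2 ⟨1, fun m hm => ?_⟩)
    have hm0 : (0 : ℝ) < m := by exact_mod_cast hm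
    have h1 : (N : ℝ) * m ^ n ≤ (D * m + c) ^ n := by exact_mod_cast h m
    have h2 : (D : ℝ) + c / m = (D * m + c) / m := by field_simp
    rw [h2, div_pow, le_div_iff₀ (by positivity)]
    exact h1
  rw [add_zero] at hle
  exact_mod_cast hle

theorem finrank_restrictTotalDegree (k : Type*) [Field k] (n m : ℕ) :
    Module.finrank k (restrictTotalDegree (Fin n) k m) = (m + n).choose n := by
  classical
  have hset : {s : Fin n →₀ ℕ | (s.sum fun _ e => e) ≤ m} =
      ((Finset.range (m + 1)).biUnion fun j => Finset.univ.finsuppAntidiag j :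
        Finset (Fin n →₀ ℕ)) := by
    ext s
    simp [Finset.mem_finsuppAntidiag, Finsupp.sum_fintype]
  have hrank := Module.finrank_eq_nat_card_basis
    (basisRestrictSupport k {s : Fin n →₀ ℕ | (s.sum fun _ e => e) ≤ m})
  rw [restrictTotalDegree, hrank, hset, Nat.card_coe_set_eq, Set.ncard_coe_finset,
    Finset.card_biUnion]
  · simp only [Finset.card_finsuppAntidiag_nat_eq_multichoose, Finset.card_univ, Fintype.card_fin]
    rw [Nat.sum_range_multichoose, add_comm m n, Nat.choose_symm_add]
  · intro i _ j _ hij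
    refine Finset.disjoint_left.2 fun s hi hj => hij ?_
    rw [Finset.mem_finsuppAntidiag] at hi hj
    exact hi.1.symm.trans hj.1

/-- Two families that agree on generators in a way compatible with the grading agree on
homogeneous polynomials. -/
theorem _root_.MvPolynomial.IsHomogeneous.aeval_rel {k σ A B : Type*} [CommRing k] [CommRing A]
    [CommRing B] [Algebra k A] [Algebra k B] (P : ℕ → A → B → Prop) (a : σ → A) (b : σ → B)
    (hX : ∀ i, P 1 (a i) (b i)) (hC : ∀ c : k, P 0 (algebraMap k A c) (algebraMap k B c))
    (h0 : ∀ n, P n 0 0)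
    (hadd : ∀ n x y x' y', P n x y → P n x' y' → P n (x + x') (y + y'))
    (hmul : ∀ n m x y x' y', P n x y → P m x' y' → P (n + m) (x * x') (y * y'))
    {f : MvPolynomial σ k} {n : ℕ} (hf : f.IsHomogeneous n) :
    P n (aeval a f) (aeval b f) := by
  classical
  have h1 : P 0 1 1 := by simpa using hC 1
  have hpow : ∀ i e, P e (a i ^ e) (b i ^ e) := by
    intro i e
    induction e with
    | zero => simpa using h1
    | succ e ih => simpa [pow_succ] using hmul _ _ _ _ _ _ ih (hX i)
  have hprod : ∀ (s : σ →₀ ℕ) (t : Finset σ),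
      P (∑ i ∈ t, s i) (∏ i ∈ t, a i ^ s i) (∏ i ∈ t, b i ^ s i) := by
    intro s t
    induction t using Finset.induction_on with
    | empty => simpa using h1
    | insert i t hi ih =>
      rw [Finset.sum_insert hi, Finset.prod_insert hi, Finset.prod_insert hi]
      exact hmul _ _ _ _ _ _ (hpow i _) ih
  have hsum : ∀ t : Finset (σ →₀ ℕ), t ⊆ f.support →
      P n (∑ s ∈ t, aeval a (monomial s (f.coeff s)))
        (∑ s ∈ t, aeval b (monomial s (f.coeff s))) := by
    intro t
    induction t using Finset.induction_on with
    | empty => intro _; simpa using h0 n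
    | insert s t hs ih =>
      intro hst
      rw [Finset.insert_subset_iff] at hst
      rw [Finset.sum_insert hs, Finset.sum_insert hs]
      refine hadd _ _ _ _ _ ?_ (ih hst.2)
      have hdeg : ∑ i ∈ s.support, s i = n := by
        have := hf (mem_support_iff.1 hst.1)
        simpa [Finsupp.weight_apply, Finsupp.sum] using this
      have := hmul _ _ _ _ _ _ (hC (f.coeff s)) (hprod s s.support)
      rw [hdeg, zero_add] at this
      simpa only [aeval_monomial, Finsupp.prod] using this
  have := hsum f.support subset_rfl
  rwa [← map_sum, ← map_sum, support_sum_monomial_coeff] at this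

theorem totalDegree_aeval_le {k σ τ : Type*} [CommRing k] {D : ℕ} (g : σ → MvPolynomial τ k)
    (hg : ∀ i, (g i).totalDegree ≤ D) (Q : MvPolynomial σ k) :
    (aeval g Q).totalDegree ≤ D * Q.totalDegree := by
  rw [aeval_def, eval₂_eq]
  refine totalDegree_finsetSum_le fun s hs => ?_
  refine (totalDegree_mul _ _).trans ?_
  have hprod : (∏ i ∈ s.support, g i ^ s i).totalDegree ≤ ∑ i ∈ s.support, D * s i := by
    refine (totalDegree_finsetProd _ _).trans (Finset.sum_le_sum fun i _ => ?_)
    refine (totalDegree_pow _ _).trans ?_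
    rw [mul_comm D]
    exact Nat.mul_le_mul_left _ (hg i)
  rw [← Finset.mul_sum] at hprod
  have h2 := Nat.mul_le_mul_left D (le_totalDegree hs)
  have h3 : (algebraMap k (MvPolynomial τ k) (coeff s Q)).totalDegree = 0 := totalDegree_C _
  rw [h3, zero_add]
  exact hprod.trans h2

/-- The restriction of a polynomial to the parametrized line `t ↦ p + t v`. -/
noncomputable def lineEval {k σ : Type*} [CommRing k] (p v : σ → k) :
    MvPolynomial σ k →ₐ[k] Polynomial k :=
  aeval fun i => Polynomial.C (p i) + Polynomial.X * Polynomial.C (v i)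

theorem eval_lineEval {k σ : Type*} [CommRing k] (p v : σ → k) (t : k) (g : MvPolynomial σ k) :
    (lineEval p v g).eval t = eval (fun i => p i + t * v i) g := by
  induction g using MvPolynomial.induction_on with
  | C a => simp [lineEval]
  | add f g hf hg => simp [hf, hg]
  | mul_X f i hf =>
    have hX : lineEval p v (X i) = Polynomial.C (p i) + Polynomial.X * Polynomial.C (v i) := by
      simp [lineEval]
    rw [map_mul, hX, Polynomial.eval_mul, hf]
    simp [mul_comm (v i)]

theorem coeff_zero_lineEval {k σ : Type*} [CommRing k] (p v : σ → k) (g : MvPolynomial σ k) :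
    (lineEval p v g).coeff 0 = eval p g := by
  rw [Polynomial.coeff_zero_eq_eval_zero, eval_lineEval]
  simp

theorem coeff_one_lineEval {k σ : Type*} [CommRing k] [Fintype σ] (p v : σ → k)
    (g : MvPolynomial σ k) :
    (lineEval p v g).coeff 1 = ∑ i, eval p (pderiv i g) * v i := by
  classical
  induction g using MvPolynomial.induction_on with
  | C a => simp [lineEval]
  | add f g hf hg => simp [hf, hg, add_mul, Finset.sum_add_distrib]
  | mul_X f j hf =>
    have h0 := coeff_zero_lineEval p v f
    have hX : lineEval p v (X j) = Polynomial.C (p j) + Polynomial.X * Polynomial.C (v j) := by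
      simp [lineEval]
    rw [map_mul, hX, mul_add, ← mul_assoc, Polynomial.coeff_add, Polynomial.coeff_mul_C,
      Polynomial.coeff_mul_C, Polynomial.coeff_mul_X, h0, hf]
    simp only [Derivation.leibniz, pderiv_X, smul_eq_mul, map_add, map_mul, eval_X, add_mul,
      Finset.sum_add_distrib, Pi.single_apply]
    rw [Finset.sum_mul, add_comm]
    congr 1
    · simp
    · exact Finset.sum_congr rfl fun i _ => by ring

theorem natDegree_lineEval_le_and_coeff {k σ : Type*} [CommRing k] (p v : σ → k) {m : ℕ}
    {g : MvPolynomial σ k} (hg : g.IsHomogeneous m) :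
    (lineEval p v g).natDegree ≤ m ∧ (lineEval p v g).coeff m = eval v g := by
  refine IsHomogeneous.aeval_rel (B := k)
    (fun n (x : Polynomial k) (y : k) => x.natDegree ≤ n ∧ x.coeff n = y) _ v
    ?_ ?_ ?_ ?_ ?_ hg
  · intro i
    refine ⟨by compute_degree, by simp [Polynomial.coeff_C]⟩
  · intro c
    simp
  · simp
  · rintro n x y x' y' ⟨h1, h2⟩ ⟨h3, h4⟩
    exact ⟨Polynomial.natDegree_add_le_of_degree_le h1 h3, by simp [h2, h4]⟩
  · rintro n m x y x' y' ⟨h1, h2⟩ ⟨h3, h4⟩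
    exact ⟨Polynomial.natDegree_mul_le_of_le h1 h3,
      by rw [Polynomial.coeff_mul_add_eq_of_natDegree_le h1 h3, h2, h4]⟩

theorem aeval_X_mul_of_isHomogeneous {k σ : Type*} [CommRing k] (u : σ → Polynomial k) {r : ℕ}
    {Q : MvPolynomial σ k} (hQ : Q.IsHomogeneous r) :
    aeval (fun i => Polynomial.X * u i) Q = Polynomial.X ^ r * aeval u Q := by
  refine IsHomogeneous.aeval_rel
    (fun n (x y : Polynomial k) => x = Polynomial.X ^ n * y) _ u ?_ ?_ ?_ ?_ ?_ hQ
  · simp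
  · simp
  · simp
  · rintro n x y x' y' rfl rfl
    ring
  · rintro n m x y x' y' rfl rfl
    ring

theorem X_pow_dvd_aeval_X_mul {k σ : Type*} [CommRing k] (u : σ → Polynomial k) (s : ℕ)
    (Q : MvPolynomial σ k) (hQ : ∀ r < s, homogeneousComponent r Q = 0) :
    Polynomial.X ^ s ∣ aeval (fun i => Polynomial.X * u i) Q := by
  rw [← sum_homogeneousComponent Q, map_sum]
  refine Finset.dvd_sum fun r _ => ?_
  rcases lt_or_ge r s with h | h
  · simp [hQ r h]
  · rw [aeval_X_mul_of_isHomogeneous u (homogeneousComponent_isHomogeneous r Q)]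
    exact (pow_dvd_pow _ h).mul_right _

theorem exists_eval_eq_ite {k σ ι : Type*} [Field k] [Fintype ι] [DecidableEq ι] (p : ι → σ → k)
    (hp : Function.Injective p) :
    ∃ h : ι → MvPolynomial σ k, ∀ i j, eval (p j) (h i) = if i = j then 1 else 0 := by
  have key : ∀ i j, ∃ q : MvPolynomial σ k, eval (p i) q = 1 ∧ (i ≠ j → eval (p j) q = 0) := by
    intro i j
    by_cases hij : i = j
    · exact ⟨1, by simp, fun h => (h hij).elim⟩
    · obtain ⟨l, hl⟩ := Function.ne_iff.1 (hp.ne hij)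
      refine ⟨C (p i l - p j l)⁻¹ * (X l - C (p j l)), ?_, fun _ => by simp⟩
      simp [inv_mul_cancel₀ (sub_ne_zero.2 hl)]
  choose q hq1 hq0 using key
  refine ⟨fun i => ∏ j, q i j, fun i j => ?_⟩
  rw [map_prod]
  split_ifs with hij
  · subst hij
    exact Finset.prod_eq_one fun j _ => hq1 i j
  · exact Finset.prod_eq_zero (Finset.mem_univ j) (hq0 i j hij)

/-- Powers of a system with invertible Jacobian at each of the points `p j` are independent over
functions separating these points. -/
theorem eq_zero_of_sum_aeval_mul_eq_zero {k ι : Type*} [Field k] [Infinite k] [Fintype ι]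
    [DecidableEq ι] {n : ℕ} (g : Fin n → MvPolynomial (Fin n) k) (p : ι → Fin n → k)
    (h0 : ∀ j i, eval (p j) (g i) = 0)
    (hdet : ∀ j, (Matrix.of fun i l => eval (p j) (pderiv l (g i))).det ≠ 0)
    (h : ι → MvPolynomial (Fin n) k) (hh : ∀ i j, eval (p j) (h i) = if i = j then 1 else 0)
    (Q : ι → MvPolynomial (Fin n) k) (hQ : ∑ i, aeval g (Q i) * h i = 0) (j : ι) : Q j = 0 := by
  have key : ∀ s j, homogeneousComponent s (Q j) = 0 := by
    intro s
    induction s using Nat.strong_induction_on with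
    | _ s ih =>
    intro j
    refine MvPolynomial.funext fun y => ?_
    set J : Matrix (Fin n) (Fin n) k := Matrix.of fun i l => eval (p j) (pderiv l (g i)) with hJ
    have hunit : IsUnit J.det := (hdet j).isUnit
    set v : Fin n → k := J⁻¹.mulVec y with hv
    have hJv : J.mulVec v = y := by
      rw [hv, Matrix.mulVec_mulVec, Matrix.mul_nonsing_inv _ hunit, Matrix.one_mulVec]
    have hdvd : ∀ i, ∃ u : Polynomial k, lineEval (p j) v (g i) = Polynomial.X * u := fun i =>
      Polynomial.X_dvd_iff.2 (by rw [coeff_zero_lineEval, h0])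
    choose u hu using hdvd
    have hu0 : ∀ i, (u i).eval 0 = y i := by
      intro i
      have h1 := coeff_one_lineEval (p j) v (g i)
      rw [hu, Polynomial.coeff_X_mul, Polynomial.coeff_zero_eq_eval_zero] at h1
      rw [h1, ← hJv]
      rfl
    have hcomp : ∀ i, lineEval (p j) v (aeval g (Q i)) =
        aeval (fun l => Polynomial.X * u l) (Q i) := by
      intro i
      rw [← AlgHom.comp_apply, comp_aeval]
      simp_rw [hu]
    have hR : ∀ i, ∃ R : Polynomial k, lineEval (p j) v (aeval g (Q i)) =
        Polynomial.X ^ s * (aeval u (homogeneousComponent s (Q i)) + Polynomial.X * R) := by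
      intro i
      obtain ⟨R, hR⟩ := X_pow_dvd_aeval_X_mul u (s + 1) (Q i - homogeneousComponent s (Q i)) (by
        intro r hr
        rw [map_sub, homogeneousComponent_of_mem (homogeneousComponent_mem s (Q i))]
        rcases Nat.lt_succ_iff_lt_or_eq.1 hr with h | h
        · rw [ih r h, if_neg h.ne, sub_zero]
        · rw [h, if_pos rfl, sub_self])
      refine ⟨R, ?_⟩
      rw [map_sub, aeval_X_mul_of_isHomogeneous u (homogeneousComponent_isHomogeneous s (Q i)),
        sub_eq_iff_eq_add] at hR
      rw [hcomp, hR]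
      ring
    choose R hR using hR
    have hsum := congrArg (lineEval (p j) v) hQ
    rw [map_sum, map_zero] at hsum
    simp_rw [map_mul, hR, mul_assoc, ← Finset.mul_sum] at hsum
    have hsum' := (mul_eq_zero.1 hsum).resolve_left (pow_ne_zero _ Polynomial.X_ne_zero)
    have hev := congrArg (Polynomial.eval 0) hsum'
    have hau : ∀ q : MvPolynomial (Fin n) k, Polynomial.eval 0 (aeval u q) = eval y q := by
      intro q
      have h1 : (Polynomial.aeval (0 : k)) (aeval u q) = aeval y q := by
        rw [← AlgHom.comp_apply, comp_aeval]
        simp only [Polynomial.coe_aeval_eq_eval, hu0]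
      simpa [Polynomial.coe_aeval_eq_eval, aeval_eq_eval] using h1
    simp only [Polynomial.eval_finsetSum, Polynomial.eval_mul, Polynomial.eval_add,
      Polynomial.eval_X, zero_mul, add_zero, hau, eval_lineEval, hh, Polynomial.eval_zero,
      mul_ite, mul_one, mul_zero, Finset.sum_ite_eq', Finset.mem_univ, if_true] at hev
    simpa using hev
  rw [← sum_homogeneousComponent (Q j)]
  exact Finset.sum_eq_zero fun s _ => key s j

/-- A square system of `n` polynomials of degree at most `D` has at most `D ^ n` nondegenerate
zeros. -/
theorem card_le_pow_of_det_ne_zero {k ι : Type*} [Field k] [Infinite k] [Fintype ι]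
    {n D : ℕ} (g : Fin n → MvPolynomial (Fin n) k) (hg : ∀ i, (g i).totalDegree ≤ D)
    (p : ι → Fin n → k) (hp : Function.Injective p) (h0 : ∀ j i, eval (p j) (g i) = 0)
    (hdet : ∀ j, (Matrix.of fun i l => eval (p j) (pderiv l (g i))).det ≠ 0) :
    Fintype.card ι ≤ D ^ n := by
  classical
  obtain ⟨h, hh⟩ := exists_eval_eq_ite p hp
  obtain ⟨e, he⟩ : ∃ e, ∀ i, (h i).totalDegree ≤ e :=
    ⟨∑ i, (h i).totalDegree, fun i =>
      Finset.single_le_sum (f := fun i => (h i).totalDegree) (fun _ _ => Nat.zero_le _)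
        (Finset.mem_univ i)⟩
  have hrank : ∀ m, Fintype.card ι * (m + n).choose n ≤ (D * m + e + n).choose n := by
    intro m
    let T : (ι → restrictTotalDegree (Fin n) k m) →ₗ[k] MvPolynomial (Fin n) k :=
      ∑ i, (LinearMap.mulRight k (h i)) ∘ₗ (aeval g).toLinearMap ∘ₗ
        (Submodule.subtype _) ∘ₗ LinearMap.proj i
    have hT : ∀ Q, T Q = ∑ i, aeval g (Q i : MvPolynomial (Fin n) k) * h i := by
      intro Q
      simp [T]
    have hmem : ∀ Q, T Q ∈ restrictTotalDegree (Fin n) k (D * m + e) := by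
      intro Q
      rw [hT, mem_restrictTotalDegree]
      refine totalDegree_finsetSum_le fun i _ => (totalDegree_mul _ _).trans ?_
      have h1 := (mem_restrictTotalDegree _ _ _).1 (Q i).2
      exact Nat.add_le_add ((totalDegree_aeval_le g hg _).trans (Nat.mul_le_mul_left D h1)) (he i)
    have hinj : Function.Injective (T.codRestrict _ hmem) := by
      rw [← LinearMap.ker_eq_bot, LinearMap.ker_codRestrict, LinearMap.ker_eq_bot']
      intro Q hQ
      rw [hT] at hQ
      funext j
      exact Subtype.ext (eq_zero_of_sum_aeval_mul_eq_zero g p h0 hdet h hh _ hQ j)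
    have := LinearMap.finrank_le_finrank_of_injective hinj
    rw [Module.finrank_pi_fintype, Finset.sum_const, finrank_restrictTotalDegree,
      finrank_restrictTotalDegree, Finset.card_univ, smul_eq_mul] at this
    exact this
  refine le_of_forall_mul_pow_le (c := e + n) fun m => ?_
  calc Fintype.card ι * m ^ n ≤ Fintype.card ι * (m + 1).ascFactorial n :=
        Nat.mul_le_mul_left _ ((Nat.pow_le_pow_left (Nat.le_succ m) n).trans
          (Nat.pow_succ_le_ascFactorial _ _))
    _ = n.factorial * (Fintype.card ι * (m + n).choose n) := by
        rw [Nat.ascFactorial_eq_factorial_mul_choose]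
        ring
    _ ≤ n.factorial * (D * m + e + n).choose n := Nat.mul_le_mul_left _ (hrank m)
    _ = (D * m + e + 1).ascFactorial n := (Nat.ascFactorial_eq_factorial_mul_choose _ _).symm
    _ ≤ (D * m + e + n) ^ n := Nat.ascFactorial_le_pow_add _ _
    _ = (D * m + (e + n)) ^ n := by rw [add_assoc]

/-- A family of matrices of full column rank whose rows are indexed by a finite type can be
compressed simultaneously to invertible square matrices. -/
theorem exists_forall_det_mul_ne_zero {k ι τ : Type*} [Field k] [Infinite k] [Fintype ι]
    [Fintype τ] {n : ℕ} (J : ι → Matrix τ (Fin n) k)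
    (hJ : ∀ j, ∃ c : Matrix (Fin n) τ k, (c * J j).det ≠ 0) :
    ∃ c : Matrix (Fin n) τ k, ∀ j, (c * J j).det ≠ 0 := by
  classical
  let A : ι → Matrix (Fin n) (Fin n) (MvPolynomial (Fin n × τ) k) := fun j =>
    Matrix.of fun i l => ∑ t, X (i, t) * C (J j t l)
  have hA : ∀ (c : Matrix (Fin n) τ k) j,
      eval (fun it : Fin n × τ => c it.1 it.2) (A j).det = (c * J j).det := by
    intro c j
    rw [RingHom.map_det]
    congr 1
    ext i l
    simp [A, Matrix.mul_apply]
  have hne : ∏ j, (A j).det ≠ 0 := by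
    refine Finset.prod_ne_zero_iff.2 fun j _ hj => ?_
    obtain ⟨c, hc⟩ := hJ j
    apply hc
    rw [← hA, hj, map_zero]
  obtain ⟨x, hx⟩ : ∃ x, eval x (∏ j, (A j).det) ≠ 0 := by
    by_contra! hcon
    exact hne (MvPolynomial.funext fun x => by rw [hcon, map_zero])
  refine ⟨Matrix.of fun i t => x (i, t), fun j => ?_⟩
  rw [map_prod, Finset.prod_ne_zero_iff] at hx
  rw [← hA]
  exact hx j (Finset.mem_univ j)

theorem exists_det_submatrix_ne_zero {k S : Type*} [Field k] {n : ℕ} (J : Matrix S (Fin n) k)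
    (hJ : ∀ v, J.mulVec v = 0 → v = 0) :
    ∃ e : Fin n → S, (J.submatrix e id).det ≠ 0 := by
  have hspan : Submodule.span k (Set.range J) = ⊤ := by
    by_contra hne
    obtain ⟨φ, hφ, hle⟩ := Submodule.exists_le_ker_of_lt_top _ (lt_top_iff_ne_top.2 hne)
    have hφv : ∀ w : Fin n → k, φ w = w ⬝ᵥ fun l => φ (Pi.single l 1) := by
      intro w
      conv_lhs => rw [pi_eq_sum_univ' w]
      simp [dotProduct, map_sum]
    have := hJ (fun l => φ (Pi.single l 1)) (by
      funext s
      exact (hφv (J s)).symm.trans (hle (Submodule.subset_span ⟨s, rfl⟩)))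
    exact hφ (LinearMap.ext fun w => by rw [hφv, this]; simp)
  have hfr : Module.finrank k (Submodule.span k (Set.range J)) = n := by
    rw [hspan, finrank_top, Module.finrank_fin_fun]
  obtain ⟨b, hb, -, hli⟩ := Submodule.exists_fun_fin_finrank_span_eq k (Set.range J)
  choose e he using hb
  refine ⟨fun i => e (Fin.cast hfr.symm i), ?_⟩
  have hli' : LinearIndependent k (J.submatrix (fun i => e (Fin.cast hfr.symm i)) id).row := by
    have hrow : (J.submatrix (fun i => e (Fin.cast hfr.symm i)) id).row =
        b ∘ Fin.cast hfr.symm := funext fun i => he _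
    rw [hrow]
    exact hli.comp _ (Fin.cast_injective hfr.symm)
  have := Matrix.linearIndependent_rows_iff_isUnit.1 hli'
  exact ((Matrix.isUnit_iff_isUnit_det _).1 this).ne_zero

/-- A system of polynomials in `n` variables of degree at most `D` has at most `D ^ n` common zeros
at which its Jacobian has full rank. -/
theorem card_le_pow_of_jacobian_injective {k ι S : Type*} [Field k] [Infinite k] [Fintype ι]
    {n D : ℕ} (G : S → MvPolynomial (Fin n) k) (hG : ∀ s, (G s).totalDegree ≤ D)
    (p : ι → Fin n → k) (hp : Function.Injective p) (h0 : ∀ j s, eval (p j) (G s) = 0)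
    (hJ : ∀ j (v : Fin n → k), (∀ s, ∑ l, eval (p j) (pderiv l (G s)) * v l = 0) → v = 0) :
    Fintype.card ι ≤ D ^ n := by
  classical
  have hsel : ∀ j, ∃ e : Fin n → S,
      ((Matrix.of fun s l => eval (p j) (pderiv l (G s))).submatrix e id).det ≠ 0 := fun j =>
    exists_det_submatrix_ne_zero _ fun v hv => hJ j v fun s => congrFun hv s
  choose e he using hsel
  obtain ⟨c, hc⟩ := exists_forall_det_mul_ne_zero (τ := ι × Fin n)
    (fun j => Matrix.of fun t l => eval (p j) (pderiv l (G (e t.1 t.2)))) (by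
      intro j
      refine ⟨Matrix.of fun i t => if t = (j, i) then 1 else 0, ?_⟩
      convert he j using 2
      ext i l
      simp [Matrix.mul_apply])
  refine card_le_pow_of_det_ne_zero (fun i => ∑ t : ι × Fin n, C (c i t) * G (e t.1 t.2))
    (fun i => ?_) p hp (fun j i => by simp [h0]) (fun j => ?_)
  · refine totalDegree_finsetSum_le fun t _ => (totalDegree_mul _ _).trans ?_
    rw [totalDegree_C, zero_add]
    exact hG _
  · convert hc j using 2
    ext i l
    simp [Matrix.mul_apply]

/-- Two univariate polynomials without common root, one of which has degree at least `2`, admit no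
nontrivial syzygy of linear polynomials. -/
theorem eq_zero_of_mul_add_mul_eq_zero {k : Type*} [Field k] [IsAlgClosed k]
    {p q a b : Polynomial k} (hpq : ∀ s, ¬ (p.eval s = 0 ∧ q.eval s = 0)) (hq : 2 ≤ q.natDegree)
    (ha : a.natDegree ≤ 1) (h : a * p + b * q = 0) : a = 0 ∧ b = 0 := by
  have hq0 : q ≠ 0 := by
    rintro rfl
    simp at hq
  have hcop : IsCoprime q p :=
    (Polynomial.isCoprime_iff_aeval_ne_zero_of_isAlgClosed k k q p).2 fun s => by
      simp only [Polynomial.coe_aeval_eq_eval]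
      have := hpq s
      tauto
  have hdvd : q ∣ a := hcop.dvd_of_dvd_mul_right ⟨-b, by linear_combination h⟩
  have ha0 : a = 0 := by
    by_contra hne
    have := Polynomial.natDegree_le_of_dvd hdvd hne
    omega
  refine ⟨ha0, ?_⟩
  rw [ha0, zero_mul, zero_add] at h
  exact (mul_eq_zero.1 h).resolve_right hq0

/-- The directional derivative of `f` at `x` along `v`, as a linear function of `v`. -/
noncomputable def dirDeriv {k : Type*} [CommRing k] (f : MvPolynomial (Fin 4) k) (x : Fin 4 → k) :
    (Fin 4 → k) →ₗ[k] k :=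
  ∑ i, eval x (pderiv i f) • LinearMap.proj i

theorem dirDeriv_apply {k : Type*} [CommRing k] (f : MvPolynomial (Fin 4) k) (x v : Fin 4 → k) :
    dirDeriv f x v = ∑ i, eval x (pderiv i f) * v i := by
  simp [dirDeriv]

theorem dirDeriv_eq_zero_of_isLineOn {k : Type*} [Field k] [Infinite k]
    {f : MvPolynomial (Fin 4) k} {W : Submodule k (Fin 4 → k)} (hW : IsLineOn f W)
    {x w : Fin 4 → k} (hx : x ∈ W) (hw : w ∈ W) : dirDeriv f x w = 0 := by
  have h0 : lineEval x w f = 0 := Polynomial.funext fun t => by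
    rw [eval_lineEval, Polynomial.eval_zero]
    exact hW.2 _ (W.add_mem hx (W.smul_mem t hw))
  rw [dirDeriv_apply, ← coeff_one_lineEval, h0, Polynomial.coeff_zero]

theorem not_dirDeriv_eq_zero {k : Type*} [Field k] [Infinite k]
    {f : MvPolynomial (Fin 4) k} {d : ℕ} (hf : IsSmoothSurface f d)
    {W L : Submodule k (Fin 4 → k)} (hW : IsLineOn f W) (hWL : W ⊔ L = ⊤)
    {x : Fin 4 → k} (hx : x ∈ W) (hx0 : x ≠ 0) : ¬ ∀ v ∈ L, dirDeriv f x v = 0 := by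
  intro h
  have htop : (⊤ : Submodule k (Fin 4 → k)) ≤ LinearMap.ker (dirDeriv f x) := by
    rw [← hWL]
    exact sup_le (fun w hw => dirDeriv_eq_zero_of_isLineOn hW hx hw) h
  refine hf.2.2 x hx0 ⟨hW.2 x hx, fun i => ?_⟩
  have : dirDeriv f x (Pi.single i 1) = 0 := htop Submodule.mem_top
  simpa [dirDeriv_apply, Pi.single_apply] using this

/-- The first order deformations of a line on a smooth surface of degree at least `3` vanish. -/
theorem eq_zero_of_forall_dirDeriv_eq_zero {k : Type*} [Field k] [IsAlgClosed k]
    {f : MvPolynomial (Fin 4) k} {d : ℕ} (hd : 3 ≤ d) (hf : IsSmoothSurface f d)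
    {W L : Submodule k (Fin 4 → k)} (hW : IsLineOn f W) (hWL : W ⊔ L = ⊤)
    {w₀ w₁ e₀ e₁ : Fin 4 → k} (hw₀ : w₀ ∈ W) (hw₁ : w₁ ∈ W)
    (hw : ∀ s t : k, s • w₀ + t • w₁ = 0 → s = 0 ∧ t = 0)
    (hL : L ≤ Submodule.span k {e₀, e₁}) (v : Fin 4 → k)
    (h : ∀ s : k, dirDeriv f (s • w₀ + w₁)
      (s • (v 0 • e₀ + v 1 • e₁) + (v 2 • e₀ + v 3 • e₁)) = 0) : v = 0 := by
  have hker : ∀ x, dirDeriv f x e₀ = 0 → dirDeriv f x e₁ = 0 → ∀ y ∈ L, dirDeriv f x y = 0 := by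
    intro x h0 h1 y hy
    obtain ⟨a, b, rfl⟩ := Submodule.mem_span_pair.1 (hL hy)
    simp [h0, h1]
  let D : (Fin 4 → k) → Polynomial k := fun e =>
    ∑ i, lineEval w₁ w₀ (pderiv i f) * Polynomial.C (e i)
  have hDeval : ∀ e s, (D e).eval s = dirDeriv f (s • w₀ + w₁) e := by
    intro e s
    rw [dirDeriv_apply]
    simp only [D, Polynomial.eval_finsetSum, Polynomial.eval_mul, Polynomial.eval_C, eval_lineEval]
    refine Finset.sum_congr rfl fun i _ => ?_
    congr 3
    funext l
    simp [add_comm]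
  have hDcoeff : ∀ e, (D e).coeff (d - 1) = dirDeriv f w₀ e := by
    intro e
    rw [dirDeriv_apply]
    simp only [D, Polynomial.finsetSum_coeff, Polynomial.coeff_mul_C,
      (natDegree_lineEval_le_and_coeff w₁ w₀ (hf.2.1.pderiv)).2]
  have hroot : ∀ s, ¬ ((D e₀).eval s = 0 ∧ (D e₁).eval s = 0) := by
    rintro s ⟨h0, h1⟩
    rw [hDeval] at h0 h1
    refine not_dirDeriv_eq_zero hf hW hWL (W.add_mem (W.smul_mem s hw₀) hw₁) (fun hx => ?_)
      (hker _ h0 h1)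
    exact one_ne_zero (hw s 1 (by rw [one_smul, hx])).2
  have hinf : ¬ ((D e₀).coeff (d - 1) = 0 ∧ (D e₁).coeff (d - 1) = 0) := by
    rintro ⟨h0, h1⟩
    rw [hDcoeff] at h0 h1
    refine not_dirDeriv_eq_zero hf hW hWL hw₀ (fun hx => ?_) (hker _ h0 h1)
    exact one_ne_zero (hw 1 0 (by rw [hx]; simp)).1
  let ℓ : k → k → Polynomial k := fun a b => Polynomial.C a * Polynomial.X + Polynomial.C b
  have hℓdeg : ∀ a b, (ℓ a b).natDegree ≤ 1 := fun a b => Polynomial.natDegree_linear_le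
  have hℓ0 : ∀ a b, ℓ a b = 0 → a = 0 ∧ b = 0 := by
    intro a b hab
    have h1 := congrArg (fun q => Polynomial.coeff q 1) hab
    have h0 := congrArg (fun q => Polynomial.coeff q 0) hab
    simp [ℓ] at h0 h1
    exact ⟨h1, h0⟩
  have hrel : ℓ (v 0) (v 2) * D e₀ + ℓ (v 1) (v 3) * D e₁ = 0 := Polynomial.funext fun s => by
    have := h s
    simp only [map_add, map_smul, smul_eq_mul] at this
    simp only [ℓ, Polynomial.eval_add, Polynomial.eval_mul, Polynomial.eval_C, Polynomial.eval_X,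
      hDeval, Polynomial.eval_zero]
    linear_combination this
  have hzero : ℓ (v 0) (v 2) = 0 ∧ ℓ (v 1) (v 3) = 0 := by
    have hdeg : ∀ q : Polynomial k, q.coeff (d - 1) ≠ 0 → 2 ≤ q.natDegree := fun q hq =>
      le_trans (by omega) (Polynomial.le_natDegree_of_ne_zero hq)
    by_cases h1 : (D e₁).coeff (d - 1) = 0
    · have h0 : (D e₀).coeff (d - 1) ≠ 0 := fun h0 => hinf ⟨h0, h1⟩
      exact (eq_zero_of_mul_add_mul_eq_zero (fun s hs => hroot s hs.symm) (hdeg _ h0)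
        (hℓdeg _ _) (by rw [add_comm]; exact hrel)).symm
    · exact eq_zero_of_mul_add_mul_eq_zero hroot (hdeg _ h1) (hℓdeg _ _) hrel
  obtain ⟨h02, h13⟩ := hzero
  obtain ⟨h0, h2⟩ := hℓ0 _ _ h02
  obtain ⟨h1, h3⟩ := hℓ0 _ _ h13
  funext i
  fin_cases i <;> simp [h0, h1, h2, h3]

/-- The point with parameter `(s : 1)` on the line spanned by `u₀ + a e₀ + b e₁` and
`u₁ + c e₀ + d e₁`, as a polynomial in `a, b, c, d`. -/
noncomputable def movingPoint {k : Type*} [CommRing k] (u₀ u₁ e₀ e₁ : Fin 4 → k) (s : k)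
    (i : Fin 4) : MvPolynomial (Fin 4) k :=
  C (s * u₀ i + u₁ i) + ((C s * X 0 + X 2) * C (e₀ i) + (C s * X 1 + X 3) * C (e₁ i))

theorem totalDegree_aeval_movingPoint_le {k : Type*} [Field k] [Infinite k]
    {f : MvPolynomial (Fin 4) k} {d : ℕ} (hd : 1 ≤ d) (hf : f.IsHomogeneous d)
    {L : Submodule k (Fin 4 → k)} (hL : IsLineOn f L) {e₀ e₁ : Fin 4 → k} (he₀ : e₀ ∈ L)
    (he₁ : e₁ ∈ L) (u₀ u₁ : Fin 4 → k) (s : k) :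
    (aeval (movingPoint u₀ u₁ e₀ e₁ s) f).totalDegree ≤ d - 1 := by
  let Y : Fin 4 → MvPolynomial (Fin 4) k := fun i =>
    (C s * X 0 + X 2) * C (e₀ i) + (C s * X 1 + X 3) * C (e₁ i)
  have hYdeg : ∀ i, (Y i).totalDegree ≤ 1 := by
    have hlin : ∀ (j l : Fin 4) (c : k),
        ((C s * X j + X l) * C c : MvPolynomial (Fin 4) k).totalDegree ≤ 1 := by
      intro j l c
      refine (totalDegree_mul _ _).trans ?_
      rw [totalDegree_C, add_zero]
      refine (totalDegree_add _ _).trans (max_le ((totalDegree_mul _ _).trans ?_) ?_)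
      · rw [totalDegree_C, totalDegree_X]
      · rw [totalDegree_X]
    exact fun i => (totalDegree_add _ _).trans (max_le (hlin _ _ _) (hlin _ _ _))
  have hY0 : aeval Y f = 0 := by
    refine MvPolynomial.funext fun x => ?_
    rw [map_zero]
    have h1 : aeval x (aeval Y f) = aeval (fun i => aeval x (Y i)) f := by
      rw [← AlgHom.comp_apply, comp_aeval]
    rw [← aeval_eq_eval, h1, aeval_eq_eval]
    convert hL.2 _ (L.add_mem (L.smul_mem (s * x 0 + x 2) he₀) (L.smul_mem (s * x 1 + x 3) he₁))
      using 3
    funext i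
    simp [Y]
  have hrel := IsHomogeneous.aeval_rel
    (fun n (x y : MvPolynomial (Fin 4) k) => x.totalDegree ≤ n ∧ y.totalDegree ≤ n ∧
      (x = y ∨ (x - y).totalDegree + 1 ≤ n)) (movingPoint u₀ u₁ e₀ e₁ s) Y
    (fun i => ⟨?_, hYdeg i, Or.inr ?_⟩) ?_ ?_ ?_ ?_ hf
  · rw [hY0, sub_zero] at hrel
    rcases hrel.2.2 with h | h
    · rw [h, totalDegree_zero]
      exact Nat.zero_le _
    · omega
  · refine (totalDegree_add _ _).trans (max_le ?_ (hYdeg i))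
    rw [totalDegree_C]
    exact zero_le_one
  · have : movingPoint u₀ u₁ e₀ e₁ s i - Y i = C (s * u₀ i + u₁ i) := add_sub_cancel_right _ _
    rw [this, totalDegree_C]
  · intro c
    exact ⟨(totalDegree_C c).le, (totalDegree_C c).le, Or.inl rfl⟩
  · simp
  · rintro n x y x' y' ⟨h1, h2, h3⟩ ⟨h4, h5, h6⟩
    refine ⟨(totalDegree_add _ _).trans (max_le h1 h4), (totalDegree_add _ _).trans (max_le h2 h5),
      ?_⟩
    rcases h3 with rfl | h3
    · rcases h6 with rfl | h6
      · exact Or.inl rfl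
      · exact Or.inr (by rwa [add_sub_add_left_eq_sub])
    · rcases h6 with rfl | h6
      · exact Or.inr (by rwa [add_sub_add_right_eq_sub])
      · refine Or.inr ?_
        have := totalDegree_add (x - y) (x' - y')
        rw [add_sub_add_comm]
        omega
  · rintro n m x y x' y' ⟨h1, h2, h3⟩ ⟨h4, h5, h6⟩
    refine ⟨(totalDegree_mul _ _).trans (add_le_add h1 h4),
      (totalDegree_mul _ _).trans (add_le_add h2 h5), ?_⟩
    rcases h3 with rfl | h3
    · rcases h6 with rfl | h6
      · exact Or.inl rfl
      · refine Or.inr ?_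
        rw [← mul_sub]
        have := totalDegree_mul x (x' - y')
        omega
    · rcases h6 with rfl | h6
      · refine Or.inr ?_
        rw [← sub_mul]
        have := totalDegree_mul (x - y) x'
        omega
      · refine Or.inr ?_
        have h7 : x * x' - y * y' = x * (x' - y') + (x - y) * y' := by ring
        have := totalDegree_add (x * (x' - y')) ((x - y) * y')
        have := totalDegree_mul x (x' - y')
        have := totalDegree_mul (x - y) y'
        rw [h7]
        omega

theorem lineEval_aeval_movingPoint {k : Type*} [CommRing k] (f : MvPolynomial (Fin 4) k)
    (u₀ u₁ e₀ e₁ : Fin 4 → k) (s : k) (p v : Fin 4 → k) :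
    lineEval p v (aeval (movingPoint u₀ u₁ e₀ e₁ s) f) =
      lineEval (s • (u₀ + (p 0 • e₀ + p 1 • e₁)) + (u₁ + (p 2 • e₀ + p 3 • e₁)))
        (s • (v 0 • e₀ + v 1 • e₁) + (v 2 • e₀ + v 3 • e₁)) f := by
  rw [← AlgHom.comp_apply, lineEval, comp_aeval]
  rw [lineEval]
  congr 2
  funext i
  have hC : ∀ c : k, (aeval fun i => Polynomial.C (p i) + Polynomial.X * Polynomial.C (v i))
      (C c : MvPolynomial (Fin 4) k) = Polynomial.C c := fun c => aeval_C _ c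
  simp only [movingPoint, map_add, map_mul, hC, aeval_X, Pi.add_apply, Pi.smul_apply, smul_eq_mul]
  ring

/-- A finite family of lines skew to `L` on a smooth surface has at most `(d - 1) ^ 4` members. -/
theorem card_le_of_isLineOn_of_inf_eq_bot {k ι : Type*} [Field k] [IsAlgClosed k] [Fintype ι]
    {d : ℕ} (hd : 3 ≤ d) {f : MvPolynomial (Fin 4) k} (hf : IsSmoothSurface f d)
    {L M : Submodule k (Fin 4 → k)} (hL : IsLineOn f L) (hM : IsLineOn f M) (hskew : L ⊓ M = ⊥)
    (W : ι → Submodule k (Fin 4 → k)) (hinj : Function.Injective W)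
    (hW : ∀ j, IsLineOn f (W j)) (hWL : ∀ j, W j ⊓ L = ⊥) :
    Fintype.card ι ≤ (d - 1) ^ 4 := by
  have : Infinite k := IsAlgClosed.instInfinite
  have hpair : ∀ N : Submodule k (Fin 4 → k), Module.finrank k N = 2 →
      ∃ x ∈ N, ∃ y ∈ N, (∀ s t : k, s • x + t • y = 0 → s = 0 ∧ t = 0) ∧
        N ≤ Submodule.span k {x, y} := by
    intro N hN
    let b := Module.finBasisOfFinrankEq k N hN
    refine ⟨b 0, (b 0).2, b 1, (b 1).2, fun s t hst => ?_, fun z hz => ?_⟩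
    · have h1 : s • b 0 + t • b 1 = 0 := Subtype.ext (by simpa using hst)
      have hb : LinearIndependent k ![b 0, b 1] := by
        convert b.linearIndependent using 1
        exact List.ofFn_inj.1 rfl
      exact LinearIndependent.pair_iff.1 hb s t h1
    · have h1 := b.sum_repr ⟨z, hz⟩
      rw [Fin.sum_univ_two] at h1
      exact Submodule.mem_span_pair.2 ⟨_, _, congrArg Subtype.val h1⟩
  obtain ⟨e₀, he₀, e₁, he₁, -, hLspan⟩ := hpair L hL.1
  obtain ⟨u₀, hu₀, u₁, hu₁, hu, -⟩ := hpair M hM.1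
  have htop : ∀ j, W j ⊔ L = ⊤ := by
    intro j
    apply Submodule.eq_top_of_finrank_eq
    have h1 := Submodule.finrank_sup_add_finrank_inf_eq (W j) L
    rw [hWL j, finrank_bot, (hW j).1, hL.1] at h1
    rw [Module.finrank_fin_fun]
    exact h1
  have hrep : ∀ j x, ∃ a b : k, x + (a • e₀ + b • e₁) ∈ W j := by
    intro j x
    have hx : x ∈ W j ⊔ L := by
      rw [htop]
      exact Submodule.mem_top
    obtain ⟨w, hw, l, hl, rfl⟩ := Submodule.mem_sup.1 hx
    obtain ⟨a, b, rfl⟩ := Submodule.mem_span_pair.1 (hLspan hl)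
    refine ⟨-a, -b, ?_⟩
    convert hw using 1
    module
  choose a₀ b₀ hw₀ using fun j => hrep j u₀
  choose a₁ b₁ hw₁ using fun j => hrep j u₁
  let p : ι → Fin 4 → k := fun j => ![a₀ j, b₀ j, a₁ j, b₁ j]
  have hw : ∀ j (s t : k), s • (u₀ + (a₀ j • e₀ + b₀ j • e₁)) +
      t • (u₁ + (a₁ j • e₀ + b₁ j • e₁)) = 0 → s = 0 ∧ t = 0 := by
    intro j s t hst
    apply hu
    have hmem : s • u₀ + t • u₁ ∈ L ⊓ M := by
      refine ⟨?_, M.add_mem (M.smul_mem _ hu₀) (M.smul_mem _ hu₁)⟩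
      have h1 : s • u₀ + t • u₁ =
          (-(s * a₀ j + t * a₁ j)) • e₀ + (-(s * b₀ j + t * b₁ j)) • e₁ := by
        rw [← sub_eq_zero, ← hst]
        module
      rw [h1]
      exact L.add_mem (L.smul_mem _ he₀) (L.smul_mem _ he₁)
    rwa [hskew, Submodule.mem_bot] at hmem
  have hpinj : Function.Injective p := by
    intro i j hij
    have h0 : a₀ i = a₀ j := congrFun hij 0
    have h1 : b₀ i = b₀ j := congrFun hij 1
    have h2 : a₁ i = a₁ j := congrFun hij 2
    have h3 : b₁ i = b₁ j := congrFun hij 3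
    set S := Submodule.span k (Set.range ![u₀ + (a₀ j • e₀ + b₀ j • e₁),
      u₁ + (a₁ j • e₀ + b₁ j • e₁)]) with hS
    have hSfr : Module.finrank k S = 2 :=
      (finrank_span_eq_card (LinearIndependent.pair_iff.2 (hw j))).trans (Fintype.card_fin 2)
    have hSeq : ∀ l, u₀ + (a₀ j • e₀ + b₀ j • e₁) ∈ W l → u₁ + (a₁ j • e₀ + b₁ j • e₁) ∈ W l →
        S = W l := by
      intro l hl0 hl1
      refine Submodule.eq_of_le_of_finrank_eq (Submodule.span_le.2 ?_) (hSfr.trans (hW l).1.symm)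
      rintro _ ⟨m, rfl⟩
      fin_cases m
      · exact hl0
      · exact hl1
    have hi0 := hw₀ i
    have hi1 := hw₁ i
    rw [h0, h1] at hi0
    rw [h2, h3] at hi1
    exact hinj ((hSeq i hi0 hi1).symm.trans (hSeq j (hw₀ j) (hw₁ j)))
  refine card_le_pow_of_jacobian_injective (fun s : k => aeval (movingPoint u₀ u₁ e₀ e₁ s) f)
    (fun s => totalDegree_aeval_movingPoint_le (by omega) hf.2.1 hL he₀ he₁ u₀ u₁ s) p hpinj
    (fun j s => ?_) (fun j v hv => ?_)
  · rw [← coeff_zero_lineEval (p j) 0, lineEval_aeval_movingPoint, coeff_zero_lineEval]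
    exact (hW j).2 _ ((W j).add_mem ((W j).smul_mem s (hw₀ j)) (hw₁ j))
  · refine eq_zero_of_forall_dirDeriv_eq_zero hd hf (hW j) (htop j) (hw₀ j) (hw₁ j) (hw j) hLspan v
      fun s => ?_
    have := hv s
    rw [← coeff_one_lineEval, lineEval_aeval_movingPoint, coeff_one_lineEval] at this
    rw [dirDeriv_apply]
    exact this

end SkewLineBound

theorem lines_skew_to_a_line_bound {k : Type*} [Field k] [IsAlgClosed k]
    (d : ℕ) (hd : 3 ≤ d)
    (f : MvPolynomial (Fin 4) k) (hf : IsSmoothSurface f d)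
    (L M : Submodule k (Fin 4 → k)) (hL : IsLineOn f L) (hM : IsLineOn f M)
    (hLM : L ≠ M) (hskew : L ⊓ M = ⊥) :
    {N : Submodule k (Fin 4 → k) | IsLineOn f N ∧ N ≠ L ∧ N ⊓ L = ⊥}.Finite ∧
      {N : Submodule k (Fin 4 → k) | IsLineOn f N ∧ N ≠ L ∧ N ⊓ L = ⊥}.ncard ≤
        (d - 1) ^ 4 := by
  set S := {N : Submodule k (Fin 4 → k) | IsLineOn f N ∧ N ≠ L ∧ N ⊓ L = ⊥}
  have hcard : ∀ T : Finset (Submodule k (Fin 4 → k)), (T : Set _) ⊆ S →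
      T.card ≤ (d - 1) ^ 4 := by
    intro T hT
    rw [← Fintype.card_coe]
    exact SkewLineBound.card_le_of_isLineOn_of_inf_eq_bot hd hf hL hM hskew
      (fun N : T => (N : Submodule k (Fin 4 → k))) Subtype.val_injective
      (fun N => (hT N.2).1) (fun N => (hT N.2).2.2)
  have hfin : S.Finite := by
    by_contra hinf
    obtain ⟨T, hT, hTcard⟩ := Set.Infinite.exists_subset_card_eq hinf ((d - 1) ^ 4 + 1)
    have := hcard T hT
    omega
  refine ⟨hfin, ?_⟩
  rw [Set.ncard_eq_toFinset_card S hfin]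
  exact hcard _ (by simp)
end

section
/- Let k be an algebraically closed field and let S = V(f) ⊆ P³ be a smooth surface of degree d ≥ 3. Let L₁, L₂, L₃ be three pairwise skew lines in P³ (not necessarily on S). Then the set of lines on S that meet all three of L₁, L₂, L₃ has cardinality at most d. -/
open MvPolynomial

theorem exists_polynomial_eval_add_smul {k σ : Type*} [Field k] [Fintype σ]
    (f : MvPolynomial σ k) (p v : σ → k) :
    ∃ P : Polynomial k, (∀ x, P.eval x = eval (p + x • v) f) ∧ P.natDegree ≤ f.totalDegree ∧
      P.derivative.eval 0 = ∑ i, v i * eval p (pderiv i f) := by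
  have heval (f : MvPolynomial σ k) (x : k) :
      (aeval (fun i => Polynomial.C (p i) + Polynomial.C (v i) * Polynomial.X) f).eval x =
        eval (p + x • v) f := by
    induction f using MvPolynomial.induction_on with
    | C a => simp
    | add f g hf hg => simp [hf, hg]
    | mul_X f i hf => simp [hf, mul_comm x]
  refine ⟨aeval (fun i => Polynomial.C (p i) + Polynomial.C (v i) * Polynomial.X) f,
    heval f, ?_, ?_⟩
  · simpa using aeval_natDegree_le (n := 1) f le_rfl
      (fun i => Polynomial.C (p i) + Polynomial.C (v i) * Polynomial.X)
      (fun i => by compute_degree)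
  · induction f using MvPolynomial.induction_on with
    | C a => simp
    | add f g hf hg => simp [hf, hg, mul_add, Finset.sum_add_distrib]
    | mul_X f i hf =>
      classical
      simp only [map_mul, aeval_X, Polynomial.derivative_mul, Polynomial.eval_add,
        Polynomial.eval_mul, hf, heval, Derivation.leibniz, pderiv_X, smul_eq_mul, map_add,
        mul_add, Finset.sum_add_distrib]
      rw [add_comm]
      congr 1
      · simp [Pi.single_apply, apply_ite, mul_comm]
      · simp [mul_comm, mul_left_comm, ← Finset.mul_sum]

theorem eval_smul_of_isHomogeneous {k σ : Type*} [CommSemiring k] {f : MvPolynomial σ k} {n : ℕ}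
    (hf : f.IsHomogeneous n) (c : k) (p : σ → k) : eval (c • p) f = c ^ n * eval p f := by
  rw [eval_eq, eval_eq, Finset.mul_sum]
  refine Finset.sum_congr rfl fun m hm => ?_
  have hdeg : ∑ i ∈ m.support, m i = n := hf.degree_eq_sum_deg_support hm |>.symm
  simp only [Pi.smul_apply, smul_eq_mul, mul_pow, Finset.prod_mul_distrib]
  rw [Finset.prod_pow_eq_pow_sum, hdeg, mul_left_comm]

/-- Two forms `A`, `B` of degree at least two on a line with `s A + t B = 0` have a common zero. -/
theorem exists_common_zero_of_mul_add_mul_eq_zero {k σ : Type*} [Field k] [IsAlgClosed k]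
    [Fintype σ] {A B : MvPolynomial σ k} {n : ℕ} (hn : 2 ≤ n) (hA : A.IsHomogeneous n)
    (e g : σ → k)
    (h : ∀ s t : k, s * eval (s • e + t • g) A + t * eval (s • e + t • g) B = 0) :
    ∃ s t : k, (s ≠ 0 ∨ t ≠ 0) ∧ eval (s • e + t • g) A = 0 ∧ eval (s • e + t • g) B = 0 := by
  obtain ⟨P, hP, -⟩ := exists_polynomial_eval_add_smul A g e
  by_cases hdeg : P.degree = 0
  · obtain ⟨Q, hQ, -⟩ := exists_polynomial_eval_add_smul B e g
    obtain ⟨c, hc⟩ : ∃ c, P = Polynomial.C c := ⟨_, Polynomial.eq_C_of_degree_eq_zero hdeg⟩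
    have hQ0 : Polynomial.X * Q + Polynomial.C c * Polynomial.X ^ n = 0 := by
      refine Polynomial.funext fun x => ?_
      rcases eq_or_ne x 0 with rfl | hx
      · simp; omega
      have h1 := h 1 x
      have h2 : eval (e + x • g) A = x ^ n * c := by
        rw [show e + x • g = x • (g + x⁻¹ • e) by
          rw [smul_add, smul_inv_smul₀ hx, add_comm], eval_smul_of_isHomogeneous hA, ← hP, hc,
          Polynomial.eval_C]
      rw [one_smul, h2, ← hQ] at h1
      simp only [Polynomial.eval_add, Polynomial.eval_mul, Polynomial.eval_X, Polynomial.eval_C,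
        Polynomial.eval_pow, Polynomial.eval_zero]
      linear_combination h1
    have hB : Q.eval 0 = 0 := by
      have := congrArg (Polynomial.coeff · 1) hQ0
      rw [← Polynomial.coeff_zero_eq_eval_zero]
      simpa [Polynomial.coeff_X_mul, Polynomial.coeff_X_pow, show 1 ≠ n by omega] using this
    refine ⟨1, 0, .inl one_ne_zero, by simpa using h 1 0, ?_⟩
    rw [hQ] at hB
    simpa using hB
  · obtain ⟨z, hz⟩ := IsAlgClosed.exists_root P hdeg
    have hA0 : eval (z • e + (1 : k) • g) A = 0 := by
      rw [one_smul, add_comm, ← hP]; exact hz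
    refine ⟨z, 1, .inr one_ne_zero, hA0, ?_⟩
    simpa only [hA0, mul_zero, zero_add, one_mul] using h z 1

/-- The derivative of `f` in a direction along which `f` vanishes is zero. -/
theorem sum_mul_eval_pderiv_eq_zero {k σ : Type*} [Field k] [Infinite k] [Fintype σ]
    {f : MvPolynomial σ k} {p v : σ → k} (h : ∀ x : k, eval (p + x • v) f = 0) :
    ∑ i, v i * eval p (pderiv i f) = 0 := by
  obtain ⟨P, hP, -, hd⟩ := exists_polynomial_eval_add_smul f p v
  have : P = 0 := Polynomial.funext fun x => by simp [hP, h]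
  rw [← hd, this]; simp

/-- A form of degree at least three vanishing on a smooth quadric surface, given by a Segre
parametrization, is singular at some point of that quadric. -/
theorem exists_singular_point_of_vanishing_on_quadric {k σ : Type*} [Field k] [IsAlgClosed k]
    [Fintype σ] {f : MvPolynomial σ k} {d : ℕ} (hd : 3 ≤ d) (hf : f.IsHomogeneous d)
    {e₁ e₂ g₁ g₂ : σ → k} (hspan : Submodule.span k {e₁, e₂, g₁, g₂} = ⊤)
    (h : ∀ s t x : k, eval (s • (e₁ + x • e₂) + t • (g₁ + x • g₂)) f = 0) :
    ∃ s t : k, (s ≠ 0 ∨ t ≠ 0) ∧ eval (s • e₁ + t • g₁) f = 0 ∧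
      ∀ i, eval (s • e₁ + t • g₁) (pderiv i f) = 0 := by
  have : Infinite k := IsAlgClosed.instInfinite
  have hD (v : σ → k) : (∑ i, C (v i) * pderiv i f).IsHomogeneous (d - 1) :=
    IsHomogeneous.sum _ _ _ fun i _ => by
      simpa using (isHomogeneous_C σ (v i)).mul hf.pderiv
  have heval (v p : σ → k) : eval p (∑ i, C (v i) * pderiv i f) =
      ∑ i, v i * eval p (pderiv i f) := by simp
  have hmix (s t : k) : s * eval (s • e₁ + t • g₁) (∑ i, C (e₂ i) * pderiv i f) +
      t * eval (s • e₁ + t • g₁) (∑ i, C (g₂ i) * pderiv i f) = 0 := by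
    rw [heval, heval, Finset.mul_sum, Finset.mul_sum, ← Finset.sum_add_distrib,
      ← sum_mul_eval_pderiv_eq_zero (f := f) (p := s • e₁ + t • g₁) (v := s • e₂ + t • g₂)]
    · exact Finset.sum_congr rfl fun i _ => by simp; ring
    · intro x
      rw [← h s t x]
      congr 2
      module
  obtain ⟨s, t, hst, h2, h4⟩ :=
    exists_common_zero_of_mul_add_mul_eq_zero (by omega) (hD e₂) e₁ g₁ hmix
  have hzero (s t : k) : eval (s • e₁ + t • g₁) f = 0 := by simpa using h s t 0
  refine ⟨s, t, hst, hzero s t, ?_⟩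
  rw [heval] at h2 h4
  set p := s • e₁ + t • g₁ with hp
  have h1 : ∑ i, e₁ i * eval p (pderiv i f) = 0 := sum_mul_eval_pderiv_eq_zero fun x => by
    rw [← hzero (s + x) t, hp]; congr 2; module
  have h3 : ∑ i, g₁ i * eval p (pderiv i f) = 0 := sum_mul_eval_pderiv_eq_zero fun x => by
    rw [← hzero s (t + x), hp]; congr 2; module
  classical
  let l : (σ → k) →ₗ[k] k := ∑ i, eval p (pderiv i f) • LinearMap.proj i
  have hl (v : σ → k) : l v = ∑ i, v i * eval p (pderiv i f) := by simp [l, mul_comm]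
  have hl0 : l = 0 := LinearMap.ext_on hspan fun v hv => by
    rw [hl, LinearMap.zero_apply]
    rcases hv with rfl | rfl | rfl | rfl <;> assumption
  intro i
  simpa [hl, Pi.single_apply] using LinearMap.congr_fun hl0 (Pi.single i 1)

theorem eq_span_pair_of_finrank_eq_two {k V : Type*} [Field k] [AddCommGroup V] [Module k V]
    {N : Submodule k V} (hN : Module.finrank k N = 2) {a b : V} (ha : a ∈ N) (hb : b ∈ N)
    (hab : LinearIndependent k ![a, b]) : N = Submodule.span k {a, b} := by
  have : FiniteDimensional k N := Module.finite_of_finrank_eq_succ hN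
  refine (Submodule.eq_of_le_of_finrank_eq (Submodule.span_le.2 ?_) ?_).symm
  · rintro v (rfl | rfl) <;> assumption
  · rw [hN, ← Matrix.range_cons_cons_empty a b ![], finrank_span_eq_card hab]
    simp

theorem linearIndependent_pair_of_disjoint {k V : Type*} [Field k] [AddCommGroup V] [Module k V]
    {L₁ L₂ : Submodule k V} (h : Disjoint L₁ L₂) {a b : V} (ha : a ∈ L₁) (hb : b ∈ L₂)
    (ha0 : a ≠ 0) (hb0 : b ≠ 0) : LinearIndependent k ![a, b] := by
  refine (LinearIndependent.pair_iff' ha0).2 fun c hc => hb0 ?_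
  exact Submodule.disjoint_def.1 h b (hc ▸ L₁.smul_mem c ha) hb

/-- Lines meeting three pairwise disjoint subspaces are spanned by a vector of the first one and
its image under a fixed linear map into the second one. -/
theorem exists_linearMap_of_transversals {k V : Type*} [Field k] [AddCommGroup V] [Module k V]
    {L₁ L₂ L₃ : Submodule k V} (h12 : Disjoint L₁ L₂) (h13 : Disjoint L₁ L₃)
    (h23 : IsCompl L₂ L₃) :
    ∃ φ : V →ₗ[k] V, (∀ v, φ v ∈ L₂) ∧ (∀ v ∈ L₁, φ v = 0 → v = 0) ∧
      ∀ N : Submodule k V, Module.finrank k N = 2 → N ⊓ L₁ ≠ ⊥ → N ⊓ L₂ ≠ ⊥ → N ⊓ L₃ ≠ ⊥ →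
        ∃ a ∈ N, a ∈ L₁ ∧ a ≠ 0 ∧ φ a ∈ N := by
  refine ⟨-L₂.projection L₃ h23, fun v => ?_, fun v hv h0 => ?_, fun N hN h1 h2 h3 => ?_⟩
  · simp
  · exact Submodule.disjoint_def.1 h13 v hv (by simpa using h0)
  · obtain ⟨a, ⟨haN, ha⟩, ha0⟩ := Submodule.exists_mem_ne_zero_of_ne_bot h1
    obtain ⟨b, ⟨hbN, hb⟩, hb0⟩ := Submodule.exists_mem_ne_zero_of_ne_bot h2
    obtain ⟨c, ⟨hcN, hc⟩, hc0⟩ := Submodule.exists_mem_ne_zero_of_ne_bot h3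
    rw [SetLike.mem_coe] at *
    rw [eq_span_pair_of_finrank_eq_two hN haN hbN
      (linearIndependent_pair_of_disjoint h12 ha hb ha0 hb0), Submodule.mem_span_pair] at hcN
    obtain ⟨α, β, rfl⟩ := hcN
    have hα : α ≠ 0 := by
      rintro rfl
      rw [zero_smul, zero_add] at hc hc0
      exact hc0 (Submodule.disjoint_def.1 h23.disjoint _ (L₂.smul_mem β hb) hc)
    have hproj := (Submodule.projection_apply_eq_zero_iff h23).2 hc
    rw [map_add, Submodule.projection_apply_of_mem_left h23 (L₂.smul_mem β hb), map_smul] at hproj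
    refine ⟨a, haN, ha, ha0, (N.smul_mem_iff hα).1 ?_⟩
    rw [LinearMap.neg_apply, smul_neg, neg_eq_of_add_eq_zero_right hproj]
    exact N.smul_mem β hbN

/-- Finitely many lines, all different from a given line `L`, miss a common point of `L`. -/
theorem exists_mem_forall_notMem {k V : Type*} [Field k] [Infinite k] [AddCommGroup V]
    [Module k V] {L : Submodule k V} (T : Finset (Submodule k V)) (hT : ∀ N ∈ T, ¬ L ≤ N) :
    ∃ v ∈ L, ∀ N ∈ T, v ∉ N := by
  classical
  have h := Subspace.biUnion_ne_univ_of_top_notMem (k := k) (E := L)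
    (s := T.image fun N => N.comap L.subtype) (by simpa [Submodule.comap_subtype_eq_top] using hT)
  obtain ⟨v, hv⟩ := (Set.ne_univ_iff_exists_notMem _).1 h
  exact ⟨v, v.2, by simpa using hv⟩

theorem lines_meeting_three_skew_lines_bound {k : Type*} [Field k] [IsAlgClosed k]
    (d : ℕ) (hd : 3 ≤ d)
    (f : MvPolynomial (Fin 4) k) (hf : IsSmoothSurface f d)
    (L₁ L₂ L₃ : Submodule k (Fin 4 → k))
    (r1 : Module.finrank k L₁ = 2) (r2 : Module.finrank k L₂ = 2)
    (r3 : Module.finrank k L₃ = 2)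
    (h12 : L₁ ≠ L₂) (h13 : L₁ ≠ L₃) (h23 : L₂ ≠ L₃)
    (s12 : L₁ ⊓ L₂ = ⊥) (s13 : L₁ ⊓ L₃ = ⊥) (s23 : L₂ ⊓ L₃ = ⊥) :
    {N : Submodule k (Fin 4 → k) | IsLineOn f N ∧
        (N ≠ L₁ ∧ N ⊓ L₁ ≠ ⊥) ∧ (N ≠ L₂ ∧ N ⊓ L₂ ≠ ⊥) ∧
        (N ≠ L₃ ∧ N ⊓ L₃ ≠ ⊥)}.Finite ∧
      {N : Submodule k (Fin 4 → k) | IsLineOn f N ∧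
        (N ≠ L₁ ∧ N ⊓ L₁ ≠ ⊥) ∧ (N ≠ L₂ ∧ N ⊓ L₂ ≠ ⊥) ∧
        (N ≠ L₃ ∧ N ⊓ L₃ ≠ ⊥)}.ncard ≤ d := by
  rw [← Set.encard_le_coe_iff_finite_ncard_le]
  by_contra! hlt
  obtain ⟨T, hTS, hTcard⟩ := Set.exists_subset_encard_eq (Order.add_one_le_of_lt hlt)
  have hTfin : T.Finite := Set.finite_of_encard_eq_coe (k := d + 1) (by simpa using hTcard)
  lift T to Finset (Submodule k (Fin 4 → k)) using hTfin
  replace hTcard : T.card = d + 1 := by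
    rw [Set.encard_coe_eq_coe_finsetCard] at hTcard
    exact_mod_cast hTcard
  have : Infinite k := IsAlgClosed.instInfinite
  have hcompl {A B : Submodule k (Fin 4 → k)} (hA : Module.finrank k A = 2)
      (hB : Module.finrank k B = 2) (hAB : A ⊓ B = ⊥) : IsCompl A B :=
    (Submodule.isCompl_iff_disjoint A B (by simp [hA, hB])).2 (disjoint_iff.2 hAB)
  have c12 := hcompl r1 r2 s12
  obtain ⟨φ, hφ, hφ0, hN⟩ := exists_linearMap_of_transversals c12.disjoint
    (disjoint_iff.2 s13) (hcompl r2 r3 s23)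
  obtain ⟨e₂, he₂, he₂T⟩ := exists_mem_forall_notMem (L := L₁) T fun N hNT hle =>
    (hTS hNT).2.1.1 (Submodule.eq_of_le_of_finrank_eq hle (r1.trans (hTS hNT).1.1.symm)).symm
  obtain ⟨N₀, hN₀⟩ : T.Nonempty := Finset.card_pos.1 (by omega)
  have hex (N) (h : N ∈ T) : ∃ a ∈ N, a ∈ L₁ ∧ a ≠ 0 ∧ φ a ∈ N :=
    hN N (hTS h).1.1 (hTS h).2.1.2 (hTS h).2.2.1.2 (hTS h).2.2.2.2
  obtain ⟨e₁, he₁N, he₁, he₁0, -⟩ := hex N₀ hN₀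
  have hind : LinearIndependent k ![e₁, e₂] := (LinearIndependent.pair_iff' he₁0).2
    fun c hc => he₂T N₀ hN₀ (hc ▸ N₀.smul_mem c he₁N)
  have hL₁ := eq_span_pair_of_finrank_eq_two r1 he₁ he₂ hind
  have hL₂ : L₂ = Submodule.span k {φ e₁, φ e₂} := by
    refine eq_span_pair_of_finrank_eq_two r2 (hφ _) (hφ _) (LinearIndependent.pair_iff.2 ?_)
    intro s t hst
    refine LinearIndependent.pair_iff.1 hind s t (hφ0 _ ?_ (by simpa using hst))
    exact add_mem (L₁.smul_mem s he₁) (L₁.smul_mem t he₂)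
  have hspan : Submodule.span k {e₁, e₂, φ e₁, φ e₂} = ⊤ := by
    rw [← c12.sup_eq_top, hL₁, hL₂, ← Submodule.span_union, Set.insert_union,
      Set.singleton_union]
  have hslope (N : T) : ∃ x : k, e₁ + x • e₂ ∈ N.1 ∧ φ (e₁ + x • e₂) ∈ N.1 := by
    obtain ⟨a, haN, ha, ha0, hφa⟩ := hex N N.2
    rw [hL₁, Submodule.mem_span_pair] at ha
    obtain ⟨c, y, rfl⟩ := ha
    have hc : c ≠ 0 := by
      rintro rfl
      rw [zero_smul, zero_add] at haN ha0
      exact he₂T N N.2 ((N.1.smul_mem_iff (left_ne_zero_of_smul ha0)).1 haN)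
    have hscale : e₁ + (c⁻¹ * y) • e₂ = c⁻¹ • (c • e₁ + y • e₂) := by
      rw [smul_add, inv_smul_smul₀ hc, mul_smul]
    refine ⟨c⁻¹ * y, ?_, ?_⟩ <;> rw [hscale]
    · exact N.1.smul_mem _ haN
    · rw [map_smul]; exact N.1.smul_mem _ hφa
  choose x hxN hxφ using hslope
  have hne (y : k) : e₁ + y • e₂ ≠ 0 := fun h => one_ne_zero
    (LinearIndependent.pair_iff.1 hind 1 y (by rwa [one_smul])).1
  have hmem (y : k) : e₁ + y • e₂ ∈ L₁ := add_mem he₁ (L₁.smul_mem y he₂)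
  have hline (y : k) : LinearIndependent k ![e₁ + y • e₂, φ (e₁ + y • e₂)] :=
    linearIndependent_pair_of_disjoint c12.disjoint (hmem y) (hφ _) (hne y)
      fun h => hne y (hφ0 _ (hmem y) h)
  have hx : Function.Injective x := fun N M h => Subtype.ext <| by
    rw [eq_span_pair_of_finrank_eq_two (hTS N.2).1.1 (hxN N) (hxφ N) (hline _),
      eq_span_pair_of_finrank_eq_two (hTS M.2).1.1 (hxN M) (hxφ M) (hline _), h]
  have hvanish (s t y : k) : eval (s • (e₁ + y • e₂) + t • (φ e₁ + y • φ e₂)) f = 0 := by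
    have hsplit (y : k) : s • (e₁ + y • e₂) + t • (φ e₁ + y • φ e₂) =
        (s • e₁ + t • φ e₁) + y • (s • e₂ + t • φ e₂) := by module
    obtain ⟨P, hP, hdeg, -⟩ :=
      exists_polynomial_eval_add_smul f (s • e₁ + t • φ e₁) (s • e₂ + t • φ e₂)
    have hP0 : P = 0 := by
      refine Polynomial.eq_zero_of_natDegree_lt_card_of_eval_eq_zero P hx (fun N => ?_) ?_
      · rw [hP, ← hsplit, ← map_smul, ← map_add]
        exact (hTS N.2).1.2 _ (add_mem (N.1.smul_mem s (hxN N)) (N.1.smul_mem t (hxφ N)))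
      · rw [Fintype.card_coe, hTcard]
        exact Nat.lt_succ_of_le (hdeg.trans hf.2.1.totalDegree_le)
    rw [hsplit, ← hP, hP0, Polynomial.eval_zero]
  obtain ⟨s, t, hst, h0, hd0⟩ :=
    exists_singular_point_of_vanishing_on_quadric hd hf.2.1 hspan hvanish
  refine hf.2.2 _ (fun hzero => ?_) ⟨h0, hd0⟩
  have h1 := hline 0
  rw [zero_smul, add_zero] at h1
  obtain ⟨rfl, rfl⟩ := LinearIndependent.pair_iff.1 h1 s t hzero
  simp at hst
end
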